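/- Let ν be a Borel probability measure supported in (0,1]^d and r > 0. Suppose β_ν(q) = liminf_n β_{ν,n}(q) for all q in a left neighborhood of q_r (or β_ν exists at q_r as a limit and is differentiable there). Then the quantization dimension D_r(ν) exists and equals r q_r/(1 − q_r). -/

import Mathlib

open MeasureTheory Filter

/-- The half-open dyadic cube of generation `n` indexed by `k ∈ ℤ^d`. -/
def dyadicCube (d n : ℕ) (k : Fin d → ℤ) : Set (EuclideanSpace ℝ (Fin d)) :=
  {x | ∀ i, (k i : ℝ) * 2 ^ (-(n : ℤ)) < x i ∧ x i ≤ ((k i : ℝ) + 1) * 2 ^ (-(n : ℤ))}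

/-- `Σ_{C ∈ D_n} ν(C)^q`, with the convention `0^0 = 0` (cubes of measure zero
are discarded). -/
noncomputable def lqSum {d : ℕ} (ν : Measure (EuclideanSpace ℝ (Fin d)))
    (n : ℕ) (q : ℝ) : ℝ :=
  ∑' k : Fin d → ℤ,
    if ν (dyadicCube d n k) = 0 then 0 else (ν (dyadicCube d n k)).toReal ^ q

/-- The `n`-th approximation `β_{ν,n}(q) = log (Σ_{C ∈ D_n} ν(C)^q) / log 2^n`. -/
noncomputable def lqSpectrumN {d : ℕ} (ν : Measure (EuclideanSpace ℝ (Fin d)))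
    (n : ℕ) (q : ℝ) : ℝ :=
  Real.log (lqSum ν n q) / (n * Real.log 2)

/-- The `L^q`-spectrum `β_ν(q) = limsup_n β_{ν,n}(q)`. -/
noncomputable def lqSpectrum {d : ℕ} (ν : Measure (EuclideanSpace ℝ (Fin d)))
    (q : ℝ) : ℝ :=
  Filter.limsup (fun n : ℕ => lqSpectrumN ν n q) Filter.atTop

open Metric in
/-- The `n`-th quantization error of order `r`. -/
noncomputable def quantError {d : ℕ} (ν : Measure (EuclideanSpace ℝ (Fin d)))
    (n : ℕ) (r : ℝ) : ℝ :=
  sInf ((fun α : Finset (EuclideanSpace ℝ (Fin d)) =>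
      (∫ x, infDist x (α : Set (EuclideanSpace ℝ (Fin d))) ^ r ∂ν) ^ (1 / r)) ''
    {α : Finset (EuclideanSpace ℝ (Fin d)) | α.Nonempty ∧ α.card ≤ n})

/-- The upper quantization dimension `D̄_r(ν) = limsup_n log n / (- log e_{n,r}(ν))`. -/
noncomputable def upperQDim {d : ℕ} (ν : Measure (EuclideanSpace ℝ (Fin d)))
    (r : ℝ) : ℝ :=
  Filter.limsup (fun n : ℕ => Real.log n / (- Real.log (quantError ν n r))) Filter.atTop

/-- The lower quantization dimension `D̲_r(ν) = liminf_n log n / (- log e_{n,r}(ν))`. -/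
noncomputable def lowerQDim {d : ℕ} (ν : Measure (EuclideanSpace ℝ (Fin d)))
    (r : ℝ) : ℝ :=
  Filter.liminf (fun n : ℕ => Real.log n / (- Real.log (quantError ν n r))) Filter.atTop


/-- The indices of the dyadic cubes of generation `n` contained in the unit cube. -/
noncomputable def dyadicGrid (d n : ℕ) : Finset (Fin d → ℤ) :=
  Fintype.piFinset fun _ => Finset.Ico 0 (2 ^ n)

/-- The index of the dyadic cube of generation `n` containing `x`. -/
noncomputable def dyadicIndex {d : ℕ} (n : ℕ) (x : EuclideanSpace ℝ (Fin d)) : Fin d → ℤ :=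
  fun i => ⌈x i * 2 ^ n⌉ - 1

/-- The half-open unit cube. -/
def unitCube (d : ℕ) : Set (EuclideanSpace ℝ (Fin d)) :=
  {x | ∀ i, x i ∈ Set.Ioc (0 : ℝ) 1}

lemma mem_dyadicCube_iff {d n : ℕ} {k : Fin d → ℤ} {x : EuclideanSpace ℝ (Fin d)} :
    x ∈ dyadicCube d n k ↔ dyadicIndex n x = k := by
  have h2 : (0 : ℝ) < 2 ^ n := by positivity
  simp only [dyadicCube, Set.mem_ofPred_eq, dyadicIndex, funext_iff, zpow_neg, zpow_natCast,
    ← div_eq_mul_inv, div_lt_iff₀ h2, le_div_iff₀ h2]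
  refine forall_congr' fun i => ?_
  rw [sub_eq_iff_eq_add, Int.ceil_eq_iff]
  push_cast
  simp

lemma dyadicIndex_mem_dyadicGrid {d : ℕ} (n : ℕ) {x : EuclideanSpace ℝ (Fin d)}
    (hx : x ∈ unitCube d) : dyadicIndex n x ∈ dyadicGrid d n := by
  have h2 : (0 : ℝ) < 2 ^ n := by positivity
  simp only [dyadicGrid, Fintype.mem_piFinset, dyadicIndex, Finset.mem_Ico]
  intro i
  obtain ⟨h0, h1⟩ := hx i
  have hpos : 0 < ⌈x i * 2 ^ n⌉ := Int.ceil_pos.2 (by positivity)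
  have hle : ⌈x i * 2 ^ n⌉ ≤ 2 ^ n := Int.ceil_le.2 (by push_cast; nlinarith)
  omega

lemma card_dyadicGrid (d n : ℕ) : (dyadicGrid d n).card = (2 ^ n) ^ d := by
  have : (2 ^ n : ℤ).toNat = 2 ^ n := by
    exact_mod_cast Int.toNat_natCast (2 ^ n)
  simp [dyadicGrid, Fintype.card_piFinset, this]

lemma measurableSet_dyadicCube (d n : ℕ) (k : Fin d → ℤ) :
    MeasurableSet (dyadicCube d n k) := by
  have : dyadicCube d n k = ⋂ i, {x : EuclideanSpace ℝ (Fin d) |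
      (k i : ℝ) * 2 ^ (-(n : ℤ)) < x i ∧ x i ≤ ((k i : ℝ) + 1) * 2 ^ (-(n : ℤ))} := by
    ext x; simp [dyadicCube]
  rw [this]
  refine MeasurableSet.iInter fun i => ?_
  have hm : Measurable fun x : EuclideanSpace ℝ (Fin d) => x i := by fun_prop
  exact hm measurableSet_Ioc

lemma pairwiseDisjoint_dyadicCube {d n : ℕ} (s : Set (Fin d → ℤ)) :
    s.PairwiseDisjoint (dyadicCube d n) := by
  intro k _ l _ hkl
  refine Set.disjoint_left.2 fun x hx hx' => hkl ?_
  rw [mem_dyadicCube_iff] at hx hx'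
  exact hx.symm.trans hx'

lemma abs_sub_le_of_mem_dyadicCube {d n : ℕ} {k : Fin d → ℤ} {x y : EuclideanSpace ℝ (Fin d)}
    (hx : x ∈ dyadicCube d n k) (hy : y ∈ dyadicCube d n k) (i : Fin d) :
    |x i - y i| ≤ (2 ^ n)⁻¹ := by
  have h1 := hx i
  have h2 := hy i
  simp only [zpow_neg, zpow_natCast] at h1 h2
  rw [abs_le]
  constructor <;> linarith

lemma dist_le_of_forall_abs_le {d : ℕ} {x y : EuclideanSpace ℝ (Fin d)} {c : ℝ} (hc : 0 ≤ c)
    (h : ∀ i, |x i - y i| ≤ c) : dist x y ≤ Real.sqrt d * c := by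
  rw [EuclideanSpace.dist_eq, ← Real.sqrt_sq hc, ← Real.sqrt_mul (by positivity)]
  refine Real.sqrt_le_sqrt ?_
  calc ∑ i, dist (x i) (y i) ^ 2 ≤ ∑ _i : Fin d, c ^ 2 :=
        Finset.sum_le_sum fun i _ => pow_le_pow_left₀ dist_nonneg (h i) 2
    _ = d * c ^ 2 := by simp

section UnitCubeMeasure

variable {d : ℕ} {ν : Measure (EuclideanSpace ℝ (Fin d))}

lemma measure_dyadicCube_eq_zero (hsupp : ν (unitCube d)ᶜ = 0) {n : ℕ} {k : Fin d → ℤ}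
    (hk : k ∉ dyadicGrid d n) : ν (dyadicCube d n k) = 0 := by
  refine measure_mono_null (fun x hx => ?_) hsupp
  refine fun hx' => hk ?_
  rw [← mem_dyadicCube_iff.1 hx]
  exact dyadicIndex_mem_dyadicGrid n hx'

lemma sum_measureReal_dyadicCube [IsProbabilityMeasure ν] (hsupp : ν (unitCube d)ᶜ = 0) (n : ℕ) :
    ∑ k ∈ dyadicGrid d n, ν.real (dyadicCube d n k) = 1 := by
  rw [← measureReal_biUnion_finset (pairwiseDisjoint_dyadicCube _)
    (fun k _ => measurableSet_dyadicCube d n k)]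
  rw [← probReal_univ (μ := ν)]
  refine measureReal_congr ?_
  refine eventuallyEq_univ.2 ?_
  filter_upwards [compl_mem_ae_iff.2 hsupp] with x hx
  rw [compl_compl] at hx
  exact Set.mem_biUnion (dyadicIndex_mem_dyadicGrid n hx) (mem_dyadicCube_iff.2 rfl)

lemma lqSum_eq_sum (hsupp : ν (unitCube d)ᶜ = 0) [IsFiniteMeasure ν] (n : ℕ) {q : ℝ}
    (hq : 0 < q) : lqSum ν n q = ∑ k ∈ dyadicGrid d n, ν.real (dyadicCube d n k) ^ q := by
  rw [lqSum, tsum_eq_sum (s := dyadicGrid d n)]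
  · refine Finset.sum_congr rfl fun k _ => ?_
    split_ifs with h
    · simp [measureReal_def, h, Real.zero_rpow hq.ne']
    · rfl
  · intro k hk
    simp [measure_dyadicCube_eq_zero hsupp hk]

variable [IsProbabilityMeasure ν]

lemma one_le_lqSum (hsupp : ν (unitCube d)ᶜ = 0) (n : ℕ) {q : ℝ} (hq : q ∈ Set.Ioo (0 : ℝ) 1) :
    1 ≤ lqSum ν n q := by
  rw [lqSum_eq_sum hsupp n hq.1, ← sum_measureReal_dyadicCube hsupp n]
  exact Finset.sum_le_sum fun k _ =>
    Real.self_le_rpow_of_le_one measureReal_nonneg measureReal_le_one hq.2.le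

lemma lqSum_le (hsupp : ν (unitCube d)ᶜ = 0) (n : ℕ) {q : ℝ} (hq : q ∈ Set.Ioo (0 : ℝ) 1) :
    lqSum ν n q ≤ (2 : ℝ) ^ (n * (d * (1 - q))) := by
  have hq0 := hq.1
  have h := Real.rpow_sum_le_const_mul_sum_rpow (dyadicGrid d n)
    (fun k => ν.real (dyadicCube d n k) ^ q) (p := 1 / q) (by rw [le_div_iff₀ hq0]; linarith [hq.2])
  have h1 : ∀ k, |ν.real (dyadicCube d n k) ^ q| = ν.real (dyadicCube d n k) ^ q :=
    fun k => abs_of_nonneg (by positivity)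
  simp only [h1] at h
  rw [← lqSum_eq_sum hsupp n hq0] at h
  have h2 : ∀ k, (ν.real (dyadicCube d n k) ^ q) ^ (1 / q) = ν.real (dyadicCube d n k) := by
    intro k
    rw [← Real.rpow_mul measureReal_nonneg, mul_one_div_cancel hq0.ne', Real.rpow_one]
  simp only [h2, sum_measureReal_dyadicCube hsupp, mul_one, card_dyadicGrid] at h
  have h0 : 0 ≤ lqSum ν n q := zero_le_one.trans (one_le_lqSum hsupp n hq)
  have h3 := Real.rpow_le_rpow (by positivity) h hq0.le
  rw [← Real.rpow_mul h0, one_div_mul_cancel hq0.ne', Real.rpow_one] at h3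
  refine h3.trans_eq ?_
  push_cast
  rw [← Real.rpow_natCast, ← Real.rpow_natCast, ← Real.rpow_mul (by norm_num),
    ← Real.rpow_mul (by norm_num), ← Real.rpow_mul (by norm_num)]
  congr 1
  field_simp

lemma lqSum_antitoneOn (hsupp : ν (unitCube d)ᶜ = 0) (n : ℕ) :
    AntitoneOn (lqSum ν n) (Set.Ioo 0 1) := by
  intro p hp q hq hpq
  rw [lqSum_eq_sum hsupp n hp.1, lqSum_eq_sum hsupp n hq.1]
  refine Finset.sum_le_sum fun k _ => ?_
  exact Real.rpow_le_rpow_of_exponent_ge_of_imp measureReal_nonneg measureReal_le_one hpq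
    (fun _ h => absurd h hq.1.ne')

lemma lqSum_eq_rpow (hsupp : ν (unitCube d)ᶜ = 0) {n : ℕ} (hn : n ≠ 0) {q : ℝ}
    (hq : q ∈ Set.Ioo (0 : ℝ) 1) : lqSum ν n q = 2 ^ (n * lqSpectrumN ν n q) := by
  have hn' : (n : ℝ) ≠ 0 := by exact_mod_cast hn
  have hpos : 0 < lqSum ν n q := zero_lt_one.trans_le (one_le_lqSum hsupp n hq)
  have hlog : Real.log 2 ≠ 0 := by positivity
  rw [Real.rpow_def_of_pos (by norm_num), lqSpectrumN]
  rw [show Real.log 2 * (n * (Real.log (lqSum ν n q) / (n * Real.log 2)))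
    = Real.log (lqSum ν n q) by field_simp, Real.exp_log hpos]

lemma lqSpectrumN_nonneg (hsupp : ν (unitCube d)ᶜ = 0) (n : ℕ) {q : ℝ}
    (hq : q ∈ Set.Ioo (0 : ℝ) 1) : 0 ≤ lqSpectrumN ν n q :=
  div_nonneg (Real.log_nonneg (one_le_lqSum hsupp n hq)) (by positivity)

lemma lqSpectrumN_le (hsupp : ν (unitCube d)ᶜ = 0) (n : ℕ) {q : ℝ}
    (hq : q ∈ Set.Ioo (0 : ℝ) 1) : lqSpectrumN ν n q ≤ d * (1 - q) := by
  have h1q : 0 ≤ 1 - q := by linarith [hq.2]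
  refine div_le_of_le_mul₀ (by positivity) (by positivity) ?_
  have h := Real.log_le_log (zero_lt_one.trans_le (one_le_lqSum hsupp n hq)) (lqSum_le hsupp n hq)
  rw [Real.log_rpow (by norm_num)] at h
  linarith

lemma isBoundedUnder_le_lqSpectrumN (hsupp : ν (unitCube d)ᶜ = 0) {q : ℝ}
    (hq : q ∈ Set.Ioo (0 : ℝ) 1) :
    IsBoundedUnder (· ≤ ·) atTop (fun n => lqSpectrumN ν n q) :=
  isBoundedUnder_of ⟨_, fun n => lqSpectrumN_le hsupp n hq⟩

lemma isBoundedUnder_ge_lqSpectrumN (hsupp : ν (unitCube d)ᶜ = 0) {q : ℝ}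
    (hq : q ∈ Set.Ioo (0 : ℝ) 1) :
    IsBoundedUnder (· ≥ ·) atTop (fun n => lqSpectrumN ν n q) :=
  isBoundedUnder_of ⟨_, fun n => lqSpectrumN_nonneg hsupp n hq⟩

lemma lqSpectrum_le (hsupp : ν (unitCube d)ᶜ = 0) {q : ℝ}
    (hq : q ∈ Set.Ioo (0 : ℝ) 1) : lqSpectrum ν q ≤ d * (1 - q) :=
  limsup_le_of_le (isBoundedUnder_ge_lqSpectrumN hsupp hq).isCoboundedUnder_le
    (Eventually.of_forall fun n => lqSpectrumN_le hsupp n hq)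

lemma lqSpectrum_antitoneOn (hsupp : ν (unitCube d)ᶜ = 0) :
    AntitoneOn (lqSpectrum ν) (Set.Ioo 0 1) := by
  intro p hp q hq hpq
  refine limsup_le_limsup (Eventually.of_forall fun n => ?_)
    (isBoundedUnder_ge_lqSpectrumN hsupp hq).isCoboundedUnder_le
    (isBoundedUnder_le_lqSpectrumN hsupp hp)
  refine div_le_div_of_nonneg_right (Real.log_le_log ?_ (lqSum_antitoneOn hsupp n hp hq hpq))
    (by positivity)
  exact zero_lt_one.trans_le (one_le_lqSum hsupp n hq)

lemma eventually_lqSum_le (hsupp : ν (unitCube d)ᶜ = 0) {q c : ℝ}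
    (hq : q ∈ Set.Ioo (0 : ℝ) 1) (hc : lqSpectrum ν q < c) :
    ∀ᶠ n : ℕ in atTop, lqSum ν n q ≤ 2 ^ (n * c) := by
  filter_upwards [eventually_lt_of_limsup_lt hc (isBoundedUnder_le_lqSpectrumN hsupp hq),
    eventually_ne_atTop 0] with n hn hn0
  rw [lqSum_eq_rpow hsupp hn0 hq]
  exact Real.rpow_le_rpow_of_exponent_le (by norm_num) (by gcongr)

lemma integrable_infDist_rpow (hsupp : ν (unitCube d)ᶜ = 0) {r : ℝ} (hr : 0 < r)
    (s : Set (EuclideanSpace ℝ (Fin d))) :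
    Integrable (fun x => Metric.infDist x s ^ r) ν := by
  refine Integrable.of_bound
    (((Metric.continuous_infDist_pt s).rpow_const fun _ => Or.inr hr.le).aestronglyMeasurable)
    ((Metric.infDist 0 s + Real.sqrt d * 1) ^ r) ?_
  filter_upwards [compl_mem_ae_iff.2 hsupp] with x hx
  rw [compl_compl] at hx
  have h0 : 0 ≤ Metric.infDist x s := Metric.infDist_nonneg
  rw [Real.norm_of_nonneg (by positivity)]
  refine Real.rpow_le_rpow h0 ((Metric.infDist_le_infDist_add_dist (y := 0)).trans ?_) hr.le
  gcongr
  refine dist_le_of_forall_abs_le zero_le_one fun i => ?_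
  have := hx i
  rw [abs_le]
  constructor <;> simp <;> linarith [this.1, this.2]

end UnitCubeMeasure

/-- The upper corner of a dyadic cube. -/
noncomputable def dyadicCorner {d : ℕ} (n : ℕ) (k : Fin d → ℤ) : EuclideanSpace ℝ (Fin d) :=
  WithLp.toLp 2 fun i => ((k i : ℝ) + 1) * 2 ^ (-(n : ℤ))

lemma dyadicCorner_mem {d : ℕ} (n : ℕ) (k : Fin d → ℤ) :
    dyadicCorner n k ∈ dyadicCube d n k := by
  intro i
  refine ⟨?_, le_rfl⟩
  simp only [dyadicCorner]
  gcongr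
  linarith

/-- The mass of a dyadic cube weighted by the `r`-th power of its side length. -/
noncomputable def cubeWeight {d : ℕ} (ν : Measure (EuclideanSpace ℝ (Fin d))) (r : ℝ) (n : ℕ)
    (k : Fin d → ℤ) : ℝ :=
  ν.real (dyadicCube d n k) * 2 ^ (-(n * r))

lemma cubeWeight_nonneg {d : ℕ} (ν : Measure (EuclideanSpace ℝ (Fin d))) (r : ℝ) (n : ℕ)
    (k : Fin d → ℤ) : 0 ≤ cubeWeight ν r n k :=
  mul_nonneg measureReal_nonneg (by positivity)

section QuantError

variable {d : ℕ} {ν : Measure (EuclideanSpace ℝ (Fin d))} {r : ℝ}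

lemma integral_infDist_rpow_nonneg (s : Set (EuclideanSpace ℝ (Fin d))) :
    0 ≤ ∫ x, Metric.infDist x s ^ r ∂ν :=
  integral_nonneg fun _ => Real.rpow_nonneg Metric.infDist_nonneg r

lemma quantError_nonneg (n : ℕ) : 0 ≤ quantError ν n r := by
  refine Real.sInf_nonneg ?_
  rintro _ ⟨α, -, rfl⟩
  exact Real.rpow_nonneg (integral_infDist_rpow_nonneg _) _

lemma quantError_le {n : ℕ} {α : Finset (EuclideanSpace ℝ (Fin d))} (hα : α.Nonempty)
    (hn : α.card ≤ n) :
    quantError ν n r ≤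
      (∫ x, Metric.infDist x (α : Set (EuclideanSpace ℝ (Fin d))) ^ r ∂ν) ^ (1 / r) := by
  refine csInf_le ⟨0, ?_⟩ ⟨α, ⟨hα, hn⟩, rfl⟩
  rintro _ ⟨α, -, rfl⟩
  exact Real.rpow_nonneg (integral_infDist_rpow_nonneg _) _

lemma le_quantError {n : ℕ} (hn : n ≠ 0) {c : ℝ}
    (h : ∀ α : Finset (EuclideanSpace ℝ (Fin d)), α.Nonempty → α.card ≤ n →
      c ≤ (∫ x, Metric.infDist x (α : Set (EuclideanSpace ℝ (Fin d))) ^ r ∂ν) ^ (1 / r)) :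
    c ≤ quantError ν n r := by
  refine le_csInf ⟨_, {0}, ⟨by simp, ?_⟩, rfl⟩ ?_
  · simpa using Nat.one_le_iff_ne_zero.2 hn
  · rintro _ ⟨α, hα, rfl⟩
    exact h α hα.1 hα.2

variable [IsProbabilityMeasure ν]

lemma sum_cubeWeight_rpow (hsupp : ν (unitCube d)ᶜ = 0) (n : ℕ) {q : ℝ} (hq : 0 < q) :
    ∑ k ∈ dyadicGrid d n, cubeWeight ν r n k ^ q = lqSum ν n q * 2 ^ (-(n * (r * q))) := by
  rw [lqSum_eq_sum hsupp n hq, Finset.sum_mul]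
  refine Finset.sum_congr rfl fun k _ => ?_
  rw [cubeWeight, Real.mul_rpow measureReal_nonneg (by positivity), ← Real.rpow_mul (by norm_num)]
  ring_nf

lemma summable_sum_cubeWeight_rpow (hsupp : ν (unitCube d)ᶜ = 0) {q : ℝ}
    (hq : q ∈ Set.Ioo (0 : ℝ) 1) (hβ : lqSpectrum ν q < r * q) :
    Summable fun n => ∑ k ∈ dyadicGrid d n, cubeWeight ν r n k ^ q := by
  obtain ⟨c, hc, hcr⟩ := exists_between hβ
  have hgeom : Summable fun n : ℕ => ((2 : ℝ) ^ (c - r * q)) ^ n :=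
    summable_geometric_of_lt_one (by positivity)
      (Real.rpow_lt_one_of_one_lt_of_neg (by norm_num) (by linarith))
  refine Summable.of_norm_bounded_eventually_nat hgeom ?_
  filter_upwards [eventually_lqSum_le hsupp hq hc] with n hn
  rw [Real.norm_of_nonneg
      (Finset.sum_nonneg fun k _ => Real.rpow_nonneg (cubeWeight_nonneg ν r n k) q),
    sum_cubeWeight_rpow hsupp n hq.1]
  refine (mul_le_mul_of_nonneg_right hn (by positivity)).trans_eq ?_
  rw [← Real.rpow_add (by norm_num), ← Real.rpow_natCast, ← Real.rpow_mul (by norm_num)]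
  ring_nf

lemma cubeWeight_zero_dyadicIndex (hsupp : ν (unitCube d)ᶜ = 0)
    {x : EuclideanSpace ℝ (Fin d)} (hx : x ∈ unitCube d) :
    cubeWeight ν r 0 (dyadicIndex 0 x) = 1 := by
  obtain ⟨a, ha⟩ := Finset.card_eq_one.1 (by simp [card_dyadicGrid] : (dyadicGrid d 0).card = 1)
  have h := sum_measureReal_dyadicCube hsupp 0
  have hmem := dyadicIndex_mem_dyadicGrid 0 hx
  rw [ha, Finset.mem_singleton] at hmem
  rw [ha, Finset.sum_singleton, ← hmem] at h
  simp [cubeWeight, h]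

/-- The upper corners of the dyadic cubes of weight at least `t` form a good quantizer. -/
lemma exists_quantizer (hsupp : ν (unitCube d)ᶜ = 0) (hr : 0 < r) {q K t : ℝ}
    (hq : q ∈ Set.Ioo (0 : ℝ) 1)
    (hK : ∀ m, ∑ n ∈ Finset.range m, ∑ k ∈ dyadicGrid d n, cubeWeight ν r n k ^ q ≤ K)
    (ht0 : 0 < t) (ht1 : t ≤ 1) :
    ∃ α : Finset (EuclideanSpace ℝ (Fin d)), α.Nonempty ∧ (α.card : ℝ) * t ^ q ≤ K ∧
      ∫ x, Metric.infDist x (α : Set (EuclideanSpace ℝ (Fin d))) ^ r ∂ν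
        ≤ ((2 * Real.sqrt d) ^ r + 1) * (K * t ^ (1 - q)) := by
  classical
  obtain ⟨n₀, hn₀⟩ : ∃ n₀ : ℕ, (2 : ℝ) ^ (-(n₀ * r)) < t := by
    obtain ⟨m, hm⟩ := exists_pow_lt_of_lt_one ht0
      (Real.rpow_lt_one_of_one_lt_of_neg (by norm_num : (1 : ℝ) < 2) (neg_lt_zero.2 hr))
    refine ⟨m, lt_of_eq_of_lt ?_ hm⟩
    rw [← Real.rpow_natCast, ← Real.rpow_mul (by norm_num)]
    ring_nf
  set I : Finset (Σ _ : ℕ, Fin d → ℤ) := (Finset.range (n₀ + 1)).sigma (dyadicGrid d) with hI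
  have hsum : ∑ p ∈ I, cubeWeight ν r p.1 p.2 ^ q ≤ K := by
    rw [hI, Finset.sum_sigma]
    exact hK _
  set H := I.filter fun p => t ≤ cubeWeight ν r p.1 p.2
  set L := I.filter fun p => cubeWeight ν r p.1 p.2 < t
  set α : Finset (EuclideanSpace ℝ (Fin d)) := H.image fun p => dyadicCorner p.1 p.2
  have hmemI : ∀ {n : ℕ} {x : EuclideanSpace ℝ (Fin d)}, n ≤ n₀ → x ∈ unitCube d →
      (⟨n, dyadicIndex n x⟩ : Σ _ : ℕ, Fin d → ℤ) ∈ I := fun hn hx =>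
    Finset.mem_sigma.2 ⟨Finset.mem_range.2 (Nat.lt_succ_of_le hn), dyadicIndex_mem_dyadicGrid _ hx⟩
  have hwt : ∀ n k, cubeWeight ν r n k ≤ 2 ^ (-(n * r)) := fun n k =>
    mul_le_of_le_one_left (by positivity) measureReal_le_one
  have hae : ∀ᵐ x ∂ν, x ∈ unitCube d := by
    filter_upwards [compl_mem_ae_iff.2 hsupp] with x hx
    rwa [compl_compl] at hx
  have hpt : ∀ x ∈ unitCube d, Metric.infDist x (α : Set (EuclideanSpace ℝ (Fin d))) ^ r ≤
      ∑ p ∈ L, (dyadicCube d p.1 p.2).indicator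
        (fun _ => (2 * Real.sqrt d) ^ r * (2 : ℝ) ^ (-(p.1 * r))) x := by
    intro x hx
    have hex : ∃ n, cubeWeight ν r n (dyadicIndex n x) < t := ⟨n₀, (hwt _ _).trans_lt hn₀⟩
    have hlt := Nat.find_spec hex
    have hle : Nat.find hex ≤ n₀ := Nat.find_min' hex ((hwt _ _).trans_lt hn₀)
    have hmin := fun m => Nat.find_min hex (m := m)
    generalize Nat.find hex = n at hlt hle hmin
    have hn : n ≠ 0 := by
      rintro rfl
      rw [cubeWeight_zero_dyadicIndex hsupp hx] at hlt
      linarith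
    obtain ⟨m, rfl⟩ := Nat.exists_eq_succ_of_ne_zero hn
    have hheavy := not_lt.1 (hmin m (Nat.lt_succ_self m))
    have hα : dyadicCorner m (dyadicIndex m x) ∈ (α : Set (EuclideanSpace ℝ (Fin d))) :=
      Finset.mem_coe.2 (Finset.mem_image.2 ⟨⟨m, dyadicIndex m x⟩,
        Finset.mem_filter.2 ⟨hmemI (by omega) hx, hheavy⟩, rfl⟩)
    have hdist : Metric.infDist x (α : Set (EuclideanSpace ℝ (Fin d))) ≤
        Real.sqrt d * (2 ^ m)⁻¹ :=
      (Metric.infDist_le_dist_of_mem hα).trans (dist_le_of_forall_abs_le (by positivity)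
        (abs_sub_le_of_mem_dyadicCube (mem_dyadicCube_iff.2 rfl) (dyadicCorner_mem _ _)))
    have hL : (⟨m + 1, dyadicIndex (m + 1) x⟩ : Σ _ : ℕ, Fin d → ℤ) ∈ L :=
      Finset.mem_filter.2 ⟨hmemI hle hx, hlt⟩
    refine le_trans ?_ (Finset.single_le_sum (f := fun p : Σ _ : ℕ, Fin d → ℤ =>
      (dyadicCube d p.1 p.2).indicator
        (fun _ => (2 * Real.sqrt d) ^ r * (2 : ℝ) ^ (-(p.1 * r))) x)
      (fun p _ => Set.indicator_nonneg (fun _ _ => by positivity) x) hL)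
    simp only
    rw [Set.indicator_of_mem (mem_dyadicCube_iff.2 rfl)]
    refine (Real.rpow_le_rpow Metric.infDist_nonneg hdist hr.le).trans_eq ?_
    rw [show (2 : ℝ) ^ (-(((m + 1 : ℕ) : ℝ) * r)) = (((2 : ℝ) ^ (m + 1))⁻¹) ^ r by
        rw [← Real.rpow_natCast, ← Real.rpow_neg (by norm_num), ← Real.rpow_mul (by norm_num)]
        ring_nf,
      ← Real.mul_rpow (by positivity) (by positivity)]
    congr 1
    rw [pow_succ]
    field_simp
  refine ⟨α, ?_, ?_, ?_⟩
  · obtain ⟨x, hx⟩ := hae.exists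
    refine ⟨dyadicCorner 0 (dyadicIndex 0 x), Finset.mem_image.2 ⟨⟨0, dyadicIndex 0 x⟩,
      Finset.mem_filter.2 ⟨hmemI (Nat.zero_le _) hx, ?_⟩, rfl⟩⟩
    rwa [cubeWeight_zero_dyadicIndex hsupp hx]
  · calc (α.card : ℝ) * t ^ q ≤ H.card * t ^ q := by
          gcongr
          exact Finset.card_image_le
      _ = ∑ _p ∈ H, t ^ q := by simp
      _ ≤ ∑ p ∈ H, cubeWeight ν r p.1 p.2 ^ q := Finset.sum_le_sum fun p hp =>
          Real.rpow_le_rpow ht0.le (Finset.mem_filter.1 hp).2 hq.1.le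
      _ ≤ ∑ p ∈ I, cubeWeight ν r p.1 p.2 ^ q :=
          Finset.sum_le_sum_of_subset_of_nonneg (Finset.filter_subset _ _)
            fun p _ _ => Real.rpow_nonneg (cubeWeight_nonneg ν r _ _) q
      _ ≤ K := hsum
  · have hterm : ∀ p ∈ L, cubeWeight ν r p.1 p.2 ≤ t ^ (1 - q) * cubeWeight ν r p.1 p.2 ^ q := by
      intro p hp
      have h0 := cubeWeight_nonneg ν r p.1 p.2
      calc cubeWeight ν r p.1 p.2 = cubeWeight ν r p.1 p.2 ^ (1 - q + q) := by simp
        _ = cubeWeight ν r p.1 p.2 ^ (1 - q) * cubeWeight ν r p.1 p.2 ^ q :=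
            Real.rpow_add' h0 (by simp)
        _ ≤ t ^ (1 - q) * cubeWeight ν r p.1 p.2 ^ q := by
            gcongr
            · linarith [hq.2]
            · exact (Finset.mem_filter.1 hp).2.le
    have hLsum : ∑ p ∈ L, cubeWeight ν r p.1 p.2 ≤ t ^ (1 - q) * K := by
      refine (Finset.sum_le_sum hterm).trans ?_
      rw [← Finset.mul_sum]
      gcongr
      exact (Finset.sum_le_sum_of_subset_of_nonneg (Finset.filter_subset _ _)
        fun p _ _ => Real.rpow_nonneg (cubeWeight_nonneg ν r _ _) q).trans hsum
    have hint : ∀ p ∈ L, Integrable ((dyadicCube d p.1 p.2).indicator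
        (fun _ => (2 * Real.sqrt d) ^ r * (2 : ℝ) ^ (-(p.1 * r)))) ν := fun p _ =>
      (integrable_const _).indicator (measurableSet_dyadicCube d p.1 p.2)
    calc ∫ x, Metric.infDist x (α : Set (EuclideanSpace ℝ (Fin d))) ^ r ∂ν
        ≤ ∫ x, ∑ p ∈ L, (dyadicCube d p.1 p.2).indicator
            (fun _ => (2 * Real.sqrt d) ^ r * (2 : ℝ) ^ (-(p.1 * r))) x ∂ν :=
          integral_mono_ae (integrable_infDist_rpow hsupp hr _) (integrable_finsetSum _ hint)
            (hae.mono hpt)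
      _ = (2 * Real.sqrt d) ^ r * ∑ p ∈ L, cubeWeight ν r p.1 p.2 := by
          rw [integral_finsetSum _ hint, Finset.mul_sum]
          refine Finset.sum_congr rfl fun p _ => ?_
          rw [integral_indicator_const _ (measurableSet_dyadicCube d p.1 p.2), cubeWeight,
            smul_eq_mul]
          ring
      _ ≤ ((2 * Real.sqrt d) ^ r + 1) * (K * t ^ (1 - q)) := by
          rw [mul_comm K]
          have h0 : 0 ≤ ∑ p ∈ L, cubeWeight ν r p.1 p.2 :=
            Finset.sum_nonneg fun p _ => cubeWeight_nonneg ν r _ _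
          have h1 : (0 : ℝ) ≤ (2 * Real.sqrt d) ^ r := by positivity
          gcongr
          linarith

lemma exists_quantError_le (hsupp : ν (unitCube d)ᶜ = 0) (hr : 0 < r) {q : ℝ}
    (hq : q ∈ Set.Ioo (0 : ℝ) 1) (hβ : lqSpectrum ν q < r * q) :
    ∃ C > 0, ∀ᶠ N : ℕ in atTop, quantError ν N r ≤ C * (N : ℝ) ^ (-((1 - q) / (r * q))) := by
  have hS := summable_sum_cubeWeight_rpow hsupp hq hβ
  have hS0 : ∀ n, 0 ≤ ∑ k ∈ dyadicGrid d n, cubeWeight ν r n k ^ q := fun n =>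
    Finset.sum_nonneg fun k _ => Real.rpow_nonneg (cubeWeight_nonneg ν r n k) q
  set K := (∑' n, ∑ k ∈ dyadicGrid d n, cubeWeight ν r n k ^ q) + 1
  have hKpos : 0 < K := add_pos_of_nonneg_of_pos (tsum_nonneg hS0) one_pos
  have hK : ∀ m, ∑ n ∈ Finset.range m, ∑ k ∈ dyadicGrid d n, cubeWeight ν r n k ^ q ≤ K := by
    intro m
    linarith [hS.sum_le_tsum (Finset.range m) fun n _ => hS0 n]
  have hq0 := hq.1
  refine ⟨(((2 * Real.sqrt d) ^ r + 1) * (K * K ^ ((1 - q) / q))) ^ (1 / r), by positivity, ?_⟩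
  filter_upwards [eventually_ge_atTop ⌈K⌉₊] with N hN
  have hKN : K ≤ N := Nat.ceil_le.1 hN
  have hN0 : (0 : ℝ) < N := hKpos.trans_le hKN
  have htq : ((K / N) ^ (1 / q)) ^ q = K / N := by
    rw [← Real.rpow_mul (by positivity), one_div_mul_cancel hq0.ne', Real.rpow_one]
  obtain ⟨α, hα, hcard, hint⟩ := exists_quantizer (t := (K / N) ^ (1 / q)) hsupp hr hq hK
    (by positivity) (Real.rpow_le_one (by positivity) ((div_le_one hN0).2 hKN) (by positivity))
  rw [htq] at hcard
  have hcard' : α.card ≤ N := by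
    have : (α.card : ℝ) ≤ N := by
      rw [mul_div_assoc', div_le_iff₀ hN0, mul_comm K] at hcard
      exact le_of_mul_le_mul_right hcard hKpos
    exact_mod_cast this
  refine (quantError_le hα hcard').trans ?_
  refine (Real.rpow_le_rpow (integral_infDist_rpow_nonneg _) hint (by positivity)).trans_eq ?_
  rw [← Real.rpow_mul (by positivity), show 1 / q * (1 - q) = (1 - q) / q by ring,
    Real.div_rpow hKpos.le hN0.le, div_eq_mul_inv, ← Real.rpow_neg hN0.le, ← mul_assoc K,
    ← mul_assoc, Real.mul_rpow (by positivity) (by positivity), ← Real.rpow_mul hN0.le]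
  congr 2
  field_simp

open Classical in
/-- A point is close to at most `5 ^ d` dyadic cubes of a given generation. -/
lemma card_filter_dist_lt_le (n : ℕ) (α : Finset (EuclideanSpace ℝ (Fin d)))
    (s : Finset (Fin d → ℤ)) :
    (s.filter fun k => ∃ a ∈ α, ∃ x ∈ dyadicCube d n k, dist x a < (2 ^ n)⁻¹).card ≤
      α.card * 5 ^ d := by
  refine (Finset.card_le_card (t := α.biUnion fun a =>
    Fintype.piFinset fun i => Finset.Icc (⌊a i * 2 ^ n⌋ - 2) (⌊a i * 2 ^ n⌋ + 2)) ?_).trans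
    (Finset.card_biUnion_le_card_mul _ _ _ fun a _ => ?_)
  · intro k hk
    obtain ⟨-, a, ha, x, hx, hxa⟩ := Finset.mem_filter.1 hk
    refine Finset.mem_biUnion.2 ⟨a, ha, Fintype.mem_piFinset.2 fun i => ?_⟩
    have hi : |x i - a i| < (2 ^ n)⁻¹ := by
      refine lt_of_le_of_lt ?_ hxa
      rw [EuclideanSpace.dist_eq]
      refine Real.le_sqrt_of_sq_le ?_
      rw [← Real.dist_eq]
      exact Finset.single_le_sum (f := fun i => dist (x i) (a i) ^ 2)
        (fun _ _ => by positivity) (Finset.mem_univ i)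
    have h2 : (0 : ℝ) < 2 ^ n := by positivity
    have hxi := hx i
    simp only [zpow_neg, zpow_natCast, ← div_eq_mul_inv, div_lt_iff₀ h2, le_div_iff₀ h2] at hxi
    rw [inv_eq_one_div, lt_div_iff₀ h2, ← abs_of_pos h2, ← abs_mul, abs_lt] at hi
    have hf1 := Int.floor_le (a i * 2 ^ n)
    have hf2 := Int.lt_floor_add_one (a i * 2 ^ n)
    rw [Finset.mem_Icc]
    constructor
    · have : ((⌊a i * 2 ^ n⌋ - 2 : ℤ) : ℝ) ≤ k i := by push_cast; linarith
      exact_mod_cast this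
    · have : ((k i : ℤ) : ℝ) ≤ ((⌊a i * 2 ^ n⌋ + 2 : ℤ) : ℝ) := by push_cast; linarith
      exact_mod_cast this
  · rw [Fintype.card_piFinset]
    refine (Finset.prod_le_pow_card _ _ 5 fun i _ => ?_).trans (by simp)
    simp only [Int.card_Icc]
    omega

lemma le_integral_infDist_rpow (hsupp : ν (unitCube d)ᶜ = 0) (hr : 0 < r) {n : ℕ} {γ M : ℝ}
    {α : Finset (EuclideanSpace ℝ (Fin d))} (hα : α.Nonempty)
    (hM : M ≤ ((dyadicGrid d n).filter fun k =>
      (2 : ℝ) ^ (-(n * γ)) ≤ ν.real (dyadicCube d n k)).card)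
    (hMα : 2 * (α.card * 5 ^ d) ≤ M) :
    (2 : ℝ) ^ (-(n * r)) * (M / 2 * 2 ^ (-(n * γ))) ≤
      ∫ x, Metric.infDist x (α : Set (EuclideanSpace ℝ (Fin d))) ^ r ∂ν := by
  classical
  set H := (dyadicGrid d n).filter fun k => (2 : ℝ) ^ (-(n * γ)) ≤ ν.real (dyadicCube d n k)
  set B := H.filter fun k => ∃ a ∈ α, ∃ x ∈ dyadicCube d n k, dist x a < (2 ^ n)⁻¹
  have hB : (B.card : ℝ) ≤ α.card * 5 ^ d := 
    (Nat.cast_le.2 (card_filter_dist_lt_le n α H)).trans_eq (by simp)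
  have hcard : M / 2 ≤ ((H \ B).card : ℝ) := by
    have h : (H.card : ℝ) = (H \ B).card + B.card := by
      exact_mod_cast (Finset.card_sdiff_add_card_eq_card (Finset.filter_subset _ H)).symm
    linarith
  have hsub : (⋃ k ∈ H \ B, dyadicCube d n k) ⊆ {x | (2 : ℝ) ^ (-(n * r)) ≤
      Metric.infDist x (α : Set (EuclideanSpace ℝ (Fin d))) ^ r} := by
    intro x hx
    obtain ⟨k, hk, hxk⟩ := Set.mem_iUnion₂.1 hx
    obtain ⟨hkH, hkB⟩ := Finset.mem_sdiff.1 hk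
    have hge : (2 ^ n : ℝ)⁻¹ ≤ Metric.infDist x (α : Set (EuclideanSpace ℝ (Fin d))) := by
      refine (Metric.le_infDist (Finset.coe_nonempty.2 hα)).2 fun a ha => ?_
      by_contra! hlt
      exact hkB (Finset.mem_filter.2 ⟨hkH, a, ha, x, hxk, hlt⟩)
    refine le_trans (le_of_eq ?_) (Real.rpow_le_rpow (by positivity) hge hr.le)
    rw [← Real.rpow_natCast, ← Real.rpow_neg (by norm_num), ← Real.rpow_mul (by norm_num)]
    ring_nf
  calc (2 : ℝ) ^ (-(n * r)) * (M / 2 * 2 ^ (-(n * γ)))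
      ≤ 2 ^ (-(n * r)) * ∑ k ∈ H \ B, ν.real (dyadicCube d n k) := by
        gcongr
        calc M / 2 * (2 : ℝ) ^ (-(n * γ)) ≤ (H \ B).card * 2 ^ (-(n * γ)) := by gcongr
          _ = ∑ _k ∈ H \ B, (2 : ℝ) ^ (-(n * γ)) := by simp
          _ ≤ _ := Finset.sum_le_sum fun k hk =>
            (Finset.mem_filter.1 (Finset.mem_sdiff.1 hk).1).2
    _ = 2 ^ (-(n * r)) * ν.real (⋃ k ∈ H \ B, dyadicCube d n k) := by
        rw [measureReal_biUnion_finset (pairwiseDisjoint_dyadicCube _)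
          (fun k _ => measurableSet_dyadicCube d n k)]
    _ ≤ 2 ^ (-(n * r)) * ν.real {x | (2 : ℝ) ^ (-(n * r)) ≤
          Metric.infDist x (α : Set (EuclideanSpace ℝ (Fin d))) ^ r} := by
        exact mul_le_mul_of_nonneg_left (measureReal_mono hsub (measure_ne_top ν _))
          (by positivity)
    _ ≤ _ := mul_meas_ge_le_integral_of_nonneg
        (Eventually.of_forall fun _ => Real.rpow_nonneg Metric.infDist_nonneg r)
        (integrable_infDist_rpow hsupp hr _) _

lemma exists_le_quantError (hsupp : ν (unitCube d)ᶜ = 0) (hr : 0 < r) {f γ : ℝ} (hf : 0 < f)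
    (hγ : f < γ + r)
    (h : ∀ᶠ n : ℕ in atTop, (2 : ℝ) ^ (n * f) ≤ ((dyadicGrid d n).filter fun k =>
      (2 : ℝ) ^ (-(n * γ)) ≤ ν.real (dyadicCube d n k)).card) :
    ∃ c > 0, ∀ᶠ N : ℕ in atTop, c * (N : ℝ) ^ (-((γ + r - f) / (r * f))) ≤ quantError ν N r := by
  set g := γ + r - f with hg
  have hg0 : 0 < g := by linarith
  set L : ℝ := 2 * 5 ^ d with hL
  have hL0 : 0 < L := by positivity
  refine ⟨(2⁻¹ * 2 ^ (-g) * L ^ (-(g / f))) ^ (1 / r), by positivity, ?_⟩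
  have hlog : Tendsto (fun N : ℕ => Real.logb 2 (L * N) / f) atTop atTop :=
    ((Real.tendsto_logb_atTop (by norm_num)).comp
      (tendsto_natCast_atTop_atTop.const_mul_atTop hL0)).atTop_div_const hf
  filter_upwards [(tendsto_nat_ceil_atTop.comp hlog).eventually h, hlog.eventually_ge_atTop 0,
    eventually_ne_atTop 0] with N hN hN1 hN0
  have hNpos : (0 : ℝ) < N := by exact_mod_cast Nat.pos_of_ne_zero hN0
  simp only [Function.comp_apply] at hN
  have hle := Nat.le_ceil (Real.logb 2 (L * N) / f)
  have hlt := (Nat.ceil_lt_add_one hN1).le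
  generalize ⌈Real.logb 2 (L * N) / f⌉₊ = n at hN hle hlt
  have hbig : L * N ≤ (2 : ℝ) ^ (n * f) := by
    rw [div_le_iff₀ hf] at hle
    exact (Real.logb_le_iff_le_rpow (by norm_num) (by positivity)).1 hle
  refine le_quantError hN0 fun α hα hcard => ?_
  have hcard' : (α.card : ℝ) ≤ N := by exact_mod_cast hcard
  have hint := le_integral_infDist_rpow hsupp hr hα hN (le_trans (by
    rw [hL]; nlinarith [mul_le_mul_of_nonneg_right hcard' (by positivity : (0 : ℝ) ≤ 5 ^ d)]) hbig)
  have hlow : 2⁻¹ * 2 ^ (-g) * L ^ (-(g / f)) * (N : ℝ) ^ (-(g / f)) ≤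
      (2 : ℝ) ^ (-(n * r)) * (2 ^ (n * f) / 2 * 2 ^ (-(n * γ))) := by
    have h1 : (2 : ℝ) ^ (-(n * r)) * (2 ^ (n * f) / 2 * 2 ^ (-(n * γ))) = 2⁻¹ * 2 ^ (-(n * g)) := by
      rw [show -(n * g) = -(n * r) + (n * f + -(n * γ)) by rw [hg]; ring,
        Real.rpow_add (by norm_num), Real.rpow_add (by norm_num)]
      ring
    have h2 : L ^ (-(g / f)) * (N : ℝ) ^ (-(g / f)) =
        (2 : ℝ) ^ (-(Real.logb 2 (L * N) / f * g)) := by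
      rw [← Real.mul_rpow hL0.le hNpos.le]
      nth_rw 1 [← Real.rpow_logb (b := 2) (by norm_num) (by norm_num)
        (by positivity : 0 < L * (N : ℝ))]
      rw [← Real.rpow_mul (by norm_num)]
      congr 1
      ring
    rw [h1, mul_assoc, mul_assoc, h2, ← Real.rpow_add (by norm_num)]
    gcongr
    · norm_num
    · nlinarith
  refine le_trans (le_of_eq ?_) (Real.rpow_le_rpow (by positivity) (hlow.trans hint)
    (by positivity : 0 ≤ 1 / r))
  rw [Real.mul_rpow (y := (N : ℝ) ^ (-(g / f))) (by positivity) (by positivity),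
    ← Real.rpow_mul hNpos.le]
  congr 2
  field_simp

end QuantError

section LogRatio

lemma tendsto_log_div_mul_log_add {a : ℝ} (ha : a ≠ 0) (b : ℝ) :
    Tendsto (fun N : ℕ => Real.log N / (a * Real.log N + b)) atTop (nhds (1 / a)) := by
  have hlog : Tendsto (fun N : ℕ => Real.log N) atTop atTop :=
    Real.tendsto_log_atTop.comp tendsto_natCast_atTop_atTop
  have h : Tendsto (fun N : ℕ => 1 / (a + b / Real.log N)) atTop (nhds (1 / (a + 0))) :=
    tendsto_const_nhds.div (tendsto_const_nhds.add (hlog.const_div_atTop b)) (by simpa)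
  rw [add_zero] at h
  refine h.congr' ?_
  filter_upwards [hlog.eventually_gt_atTop 0] with N hN
  rw [show a * Real.log N + b = (a + b / Real.log N) * Real.log N by field_simp]
  rw [div_mul_eq_div_div_swap, div_self hN.ne']

variable {e : ℕ → ℝ}

lemma eventually_log_ratio_mem (h0 : ∀ N, 0 ≤ e N) {a C : ℝ} (ha : 0 < a) (hC : 0 < C)
    (h : ∀ᶠ N : ℕ in atTop, e N ≤ C * (N : ℝ) ^ (-a)) :
    ∀ᶠ N : ℕ in atTop, 0 ≤ Real.log N / (-Real.log (e N)) ∧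
      Real.log N / (-Real.log (e N)) ≤ Real.log N / (a * Real.log N + -Real.log C) := by
  have hlog : Tendsto (fun N : ℕ => a * Real.log N + -Real.log C) atTop atTop :=
    tendsto_atTop_add_const_right _ _ ((Real.tendsto_log_atTop.comp
      tendsto_natCast_atTop_atTop).const_mul_atTop ha)
  filter_upwards [h, hlog.eventually_gt_atTop 0, eventually_gt_atTop 0] with N hN hpos hN0
  have hNpos : (0 : ℝ) < N := by exact_mod_cast hN0
  have hlogN : 0 ≤ Real.log N := Real.log_natCast_nonneg N
  rcases (h0 N).eq_or_lt with he | he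
  · rw [← he]
    simpa using div_nonneg hlogN hpos.le
  · have hle := Real.log_le_log he hN
    rw [Real.log_mul hC.ne' (by positivity), Real.log_rpow hNpos] at hle
    have hle' : a * Real.log N + -Real.log C ≤ -Real.log (e N) := by linarith
    exact ⟨div_nonneg hlogN (hpos.le.trans hle'), div_le_div_of_nonneg_left hlogN hpos hle'⟩

lemma isBoundedUnder_ge_log_ratio (h0 : ∀ N, 0 ≤ e N) {a C : ℝ} (ha : 0 < a) (hC : 0 < C)
    (h : ∀ᶠ N : ℕ in atTop, e N ≤ C * (N : ℝ) ^ (-a)) :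
    IsBoundedUnder (· ≥ ·) atTop fun N : ℕ => Real.log N / (-Real.log (e N)) :=
  isBoundedUnder_of_eventually_ge ((eventually_log_ratio_mem h0 ha hC h).mono fun _ hN => hN.1)

lemma isBoundedUnder_le_log_ratio (h0 : ∀ N, 0 ≤ e N) {a C : ℝ} (ha : 0 < a) (hC : 0 < C)
    (h : ∀ᶠ N : ℕ in atTop, e N ≤ C * (N : ℝ) ^ (-a)) :
    IsBoundedUnder (· ≤ ·) atTop fun N : ℕ => Real.log N / (-Real.log (e N)) :=
  (tendsto_log_div_mul_log_add ha.ne' _).isBoundedUnder_le.mono_le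
    ((eventually_log_ratio_mem h0 ha hC h).mono fun _ hN => hN.2)

lemma limsup_log_ratio_le (h0 : ∀ N, 0 ≤ e N) {a C : ℝ} (ha : 0 < a) (hC : 0 < C)
    (h : ∀ᶠ N : ℕ in atTop, e N ≤ C * (N : ℝ) ^ (-a)) :
    limsup (fun N : ℕ => Real.log N / (-Real.log (e N))) atTop ≤ 1 / a := by
  have ht := tendsto_log_div_mul_log_add ha.ne' (-Real.log C)
  rw [← ht.limsup_eq]
  exact limsup_le_limsup ((eventually_log_ratio_mem h0 ha hC h).mono fun _ hN => hN.2)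
    (isBoundedUnder_ge_log_ratio h0 ha hC h).isCoboundedUnder_le ht.isBoundedUnder_le

lemma le_liminf_log_ratio (h0 : ∀ N, 0 ≤ e N) {a C : ℝ} (ha : 0 < a) (hC : 0 < C)
    (h : ∀ᶠ N : ℕ in atTop, e N ≤ C * (N : ℝ) ^ (-a)) {A c : ℝ} (hA : 0 < A) (hc : 0 < c)
    (h' : ∀ᶠ N : ℕ in atTop, c * (N : ℝ) ^ (-A) ≤ e N) :
    1 / A ≤ liminf (fun N : ℕ => Real.log N / (-Real.log (e N))) atTop := by
  have ht := tendsto_log_div_mul_log_add hA.ne' (-Real.log c)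
  rw [← ht.liminf_eq]
  refine liminf_le_liminf ?_ ht.isBoundedUnder_ge
    (isBoundedUnder_le_log_ratio h0 ha hC h).isCoboundedUnder_ge
  have hlog : Tendsto (fun N : ℕ => a * Real.log N + -Real.log C) atTop atTop :=
    tendsto_atTop_add_const_right _ _ ((Real.tendsto_log_atTop.comp
      tendsto_natCast_atTop_atTop).const_mul_atTop ha)
  filter_upwards [h, h', hlog.eventually_gt_atTop 0, eventually_gt_atTop 0] with N hN hN' hpos hN0
  have hNpos : (0 : ℝ) < N := by exact_mod_cast hN0
  have he : 0 < e N := lt_of_lt_of_le (by positivity) hN'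
  have hle := Real.log_le_log he hN
  have hle' := Real.log_le_log (by positivity) hN'
  rw [Real.log_mul (by positivity) (by positivity), Real.log_rpow hNpos] at hle hle'
  exact div_le_div_of_nonneg_left (Real.log_natCast_nonneg N) (by linarith) (by linarith)

end LogRatio

section Main

variable {d : ℕ} {ν : Measure (EuclideanSpace ℝ (Fin d))} [IsProbabilityMeasure ν] {r : ℝ}

lemma eventually_le_lqSum (hsupp : ν (unitCube d)ᶜ = 0) {q c : ℝ}
    (hq : q ∈ Set.Ioo (0 : ℝ) 1)
    (hlim : Tendsto (fun n : ℕ => lqSpectrumN ν n q) atTop (nhds (lqSpectrum ν q)))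
    (hc : c < lqSpectrum ν q) : ∀ᶠ n : ℕ in atTop, 2 ^ (n * c) ≤ lqSum ν n q := by
  filter_upwards [hlim.eventually (lt_mem_nhds hc), eventually_ne_atTop 0] with n hn hn0
  rw [lqSum_eq_rpow hsupp hn0 hq]
  exact Real.rpow_le_rpow_of_exponent_le (by norm_num) (by gcongr)

/-- Split `Σ ν(C)^q` into small, large and intermediate cubes. -/
lemma lqSum_le_add_card (hsupp : ν (unitCube d)ᶜ = 0) {q h s t : ℝ} (hh : 0 < h) (hhq : h < q)
    (n : ℕ) :
    lqSum ν n q ≤ 2 ^ (-(n * s * h)) * lqSum ν n (q - h) + 2 ^ (n * t * h) * lqSum ν n (q + h) +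
      ((dyadicGrid d n).filter fun k => (2 : ℝ) ^ (-(n * s)) ≤ ν.real (dyadicCube d n k)).card *
        2 ^ (-(n * t * q)) := by
  rw [lqSum_eq_sum hsupp n (hh.trans hhq), lqSum_eq_sum hsupp n (by linarith : 0 < q - h),
    lqSum_eq_sum hsupp n (by linarith : 0 < q + h), Finset.card_filter, Nat.cast_sum,
    Finset.mul_sum, Finset.mul_sum, Finset.sum_mul, ← Finset.sum_add_distrib,
    ← Finset.sum_add_distrib]
  refine Finset.sum_le_sum fun k _ => ?_
  have hp : 0 ≤ ν.real (dyadicCube d n k) := measureReal_nonneg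
  generalize ν.real (dyadicCube d n k) = p at hp
  have hq0 : 0 < q := hh.trans hhq
  have hA : (0 : ℝ) ≤ 2 ^ (-(n * s * h)) * p ^ (q - h) := by positivity
  have hB : (0 : ℝ) ≤ 2 ^ (n * t * h) * p ^ (q + h) := by positivity
  have hC : (0 : ℝ) ≤ ((if (2 : ℝ) ^ (-(n * s)) ≤ p then 1 else 0 : ℕ) : ℝ) *
      2 ^ (-(n * t * q)) := by positivity
  rcases lt_or_ge p ((2 : ℝ) ^ (-(n * s))) with h1 | h1
  · suffices p ^ q ≤ 2 ^ (-(n * s * h)) * p ^ (q - h) by linarith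
    calc p ^ q = p ^ (h + (q - h)) := by ring_nf
      _ = p ^ h * p ^ (q - h) := Real.rpow_add' hp (by linarith)
      _ ≤ ((2 : ℝ) ^ (-(n * s))) ^ h * p ^ (q - h) := by gcongr
      _ = _ := by rw [← Real.rpow_mul (by norm_num)]; ring_nf
  · rcases lt_or_ge ((2 : ℝ) ^ (-(n * t))) p with h2 | h2
    · suffices p ^ q ≤ 2 ^ (n * t * h) * p ^ (q + h) by linarith
      have hp0 : 0 < p := lt_of_lt_of_le (by positivity) h1
      calc p ^ q = 2 ^ (n * t * h) * (((2 : ℝ) ^ (-(n * t))) ^ h * p ^ q) := by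
            rw [← Real.rpow_mul (by norm_num), ← mul_assoc, ← Real.rpow_add (by norm_num)]
            simp
        _ ≤ 2 ^ (n * t * h) * (p ^ h * p ^ q) := by gcongr
        _ = _ := by rw [← Real.rpow_add hp0, add_comm h]
    · suffices p ^ q ≤ 2 ^ (-(n * t * q)) by
        rw [if_pos h1] at hC ⊢
        push_cast
        linarith
      calc p ^ q ≤ ((2 : ℝ) ^ (-(n * t))) ^ q := by gcongr
        _ = _ := by rw [← Real.rpow_mul (by norm_num)]; ring_nf

lemma eventually_rpow_le_card (hsupp : ν (unitCube d)ᶜ = 0) {q b δ : ℝ}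
    (hq : q ∈ Set.Ioo (0 : ℝ) 1) (hδ : 0 < δ)
    (hlim : Tendsto (fun n : ℕ => lqSpectrumN ν n q) atTop (nhds (lqSpectrum ν q)))
    (hb : HasDerivAt (lqSpectrum ν) (-b) q) (hrq : r * q ≤ lqSpectrum ν q) :
    ∀ᶠ n : ℕ in atTop, (2 : ℝ) ^ (n * ((r + b) * q - 4 * δ)) ≤ ((dyadicGrid d n).filter fun k =>
      (2 : ℝ) ^ (-(n * (b + 3 * δ))) ≤ ν.real (dyadicCube d n k)).card := by
  obtain ⟨ε, hε, hball⟩ := Metric.eventually_nhds_iff.1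
    ((hasDerivAt_iff_isLittleO.1 hb).def hδ)
  obtain ⟨hq0, hq1⟩ := hq
  obtain ⟨h, hh0, hh⟩ := exists_between (lt_min hε (lt_min hq0 (sub_pos.2 hq1)))
  have hhε : h < ε := hh.trans_le (min_le_left _ _)
  have hhq : h < q := hh.trans_le ((min_le_right _ _).trans (min_le_left _ _))
  have hhq1 : h < 1 - q := hh.trans_le ((min_le_right _ _).trans (min_le_right _ _))
  have hleft : lqSpectrum ν (q - h) < lqSpectrum ν q + (b + 2 * δ) * h := by
    have := hball (y := q - h) (by rw [Real.dist_eq]; simpa [abs_of_pos hh0])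
    simp only [smul_eq_mul, Real.norm_eq_abs, sub_sub_cancel_left, abs_neg, abs_of_pos hh0] at this
    nlinarith [(abs_le.1 this).2]
  have hright : lqSpectrum ν (q + h) < lqSpectrum ν q - (b - 2 * δ) * h := by
    have := hball (y := q + h) (by rw [Real.dist_eq]; simpa [abs_of_pos hh0])
    simp only [smul_eq_mul, Real.norm_eq_abs, add_sub_cancel_left, abs_of_pos hh0] at this
    nlinarith [(abs_le.1 this).2]
  have hthree : ∀ᶠ n : ℕ in atTop, (3 : ℝ) ≤ 2 ^ (n * (δ * h / 2)) := by
    have : Tendsto (fun n : ℕ => (2 : ℝ) ^ (n * (δ * h / 2))) atTop atTop :=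
      (tendsto_rpow_atTop_of_base_gt_one 2 (by norm_num)).comp
        (tendsto_natCast_atTop_atTop.atTop_mul_const (by positivity))
    exact this.eventually_ge_atTop 3
  have hδh : 0 < δ * h := by positivity
  filter_upwards [eventually_lqSum_le hsupp ⟨by linarith, by linarith⟩ hleft,
    eventually_lqSum_le hsupp ⟨by linarith, by linarith⟩ hright, hthree,
    eventually_le_lqSum hsupp ⟨hq0, hq1⟩ hlim (by linarith :
      lqSpectrum ν q - δ * h / 2 < lqSpectrum ν q)] with n h1 h2 h3 h4
  have hsplit := lqSum_le_add_card (s := b + 3 * δ) (t := b - 3 * δ) hsupp hh0 hhq n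
  set M : ℝ := (((dyadicGrid d n).filter fun k =>
    (2 : ℝ) ^ (-(n * (b + 3 * δ))) ≤ ν.real (dyadicCube d n k)).card : ℝ)
  set X : ℝ := 2 ^ (n * (lqSpectrum ν q - δ * h)) with hX
  have e1 : (2 : ℝ) ^ (-(n * (b + 3 * δ) * h)) * lqSum ν n (q - h) ≤ X := by
    refine (mul_le_mul_of_nonneg_left h1 (by positivity)).trans_eq ?_
    rw [← Real.rpow_add (by norm_num), hX]
    ring_nf
  have e2 : (2 : ℝ) ^ (n * (b - 3 * δ) * h) * lqSum ν n (q + h) ≤ X := by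
    refine (mul_le_mul_of_nonneg_left h2 (by positivity)).trans_eq ?_
    rw [← Real.rpow_add (by norm_num), hX]
    ring_nf
  have e3 : 3 * X ≤ lqSum ν n q := by
    refine le_trans (mul_le_mul_of_nonneg_right h3 (by positivity)) (le_trans (le_of_eq ?_) h4)
    rw [← Real.rpow_add (by norm_num)]
    ring_nf
  have e4 : X ≤ M * 2 ^ (-(n * (b - 3 * δ) * q)) := by linarith
  calc (2 : ℝ) ^ (n * ((r + b) * q - 4 * δ))
      ≤ 2 ^ (n * (lqSpectrum ν q - δ * h) + n * (b - 3 * δ) * q) := by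
        refine Real.rpow_le_rpow_of_exponent_le (by norm_num) ?_
        rw [mul_assoc (n : ℝ), ← mul_add]
        gcongr
        nlinarith
    _ = X * 2 ^ (n * (b - 3 * δ) * q) := Real.rpow_add (by norm_num) _ _
    _ ≤ M * 2 ^ (-(n * (b - 3 * δ) * q)) * 2 ^ (n * (b - 3 * δ) * q) := by gcongr
    _ = M := by rw [mul_assoc, ← Real.rpow_add (by norm_num)]; simp

lemma upperQDim_le (hsupp : ν (unitCube d)ᶜ = 0) (hr : 0 < r) {q : ℝ}
    (hq : q ∈ Set.Ioo (0 : ℝ) 1) (hβ : lqSpectrum ν q < r * q) :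
    upperQDim ν r ≤ r * q / (1 - q) := by
  obtain ⟨C, hC, h⟩ := exists_quantError_le hsupp hr hq hβ
  have ha : 0 < (1 - q) / (r * q) := div_pos (by linarith [hq.2]) (mul_pos hr hq.1)
  have := limsup_log_ratio_le (fun _ => quantError_nonneg _) ha hC h
  rwa [one_div_div] at this

lemma le_lowerQDim (hsupp : ν (unitCube d)ᶜ = 0) (hr : 0 < r) {p q : ℝ}
    (hp : p ∈ Set.Ioo (0 : ℝ) 1) (hβ : lqSpectrum ν p < r * p) (hq : q ∈ Set.Ioo (0 : ℝ) 1)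
    (hlim : Tendsto (fun n : ℕ => lqSpectrumN ν n q) atTop (nhds (lqSpectrum ν q)))
    (hdiff : DifferentiableAt ℝ (lqSpectrum ν) q) (hrq : r * q ≤ lqSpectrum ν q) :
    r * q / (1 - q) ≤ lowerQDim ν r := by
  obtain ⟨C, hC, h⟩ := exists_quantError_le hsupp hr hp hβ
  have ha : 0 < (1 - p) / (r * p) := div_pos (by linarith [hp.2]) (mul_pos hr hp.1)
  obtain ⟨hq0, hq1⟩ := hq
  obtain ⟨b, hb⟩ : ∃ b, deriv (lqSpectrum ν) q = -b := ⟨_, (neg_neg _).symm⟩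
  have hderiv : HasDerivAt (lqSpectrum ν) (-b) q := hb ▸ hdiff.hasDerivAt
  have hb0 : 0 ≤ b := by
    have h1 := (lqSpectrum_antitoneOn hsupp).derivWithin_nonpos (x := q)
    rw [derivWithin_of_isOpen isOpen_Ioo ⟨hq0, hq1⟩, hb] at h1
    linarith
  have hrb : 0 < r + b := by linarith
  have ht : Tendsto (fun δ : ℝ => r * ((r + b) * q - 4 * δ) / ((r + b) * (1 - q) + 7 * δ))
      (nhdsWithin 0 (Set.Ioi 0))
      (nhds (r * ((r + b) * q - 4 * 0) / ((r + b) * (1 - q) + 7 * 0))) := by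
    refine Tendsto.mono_left (ContinuousAt.tendsto ?_) nhdsWithin_le_nhds
    refine ContinuousAt.div (by fun_prop) (by fun_prop) ?_
    have : 0 < (r + b) * (1 - q) := mul_pos hrb (by linarith)
    simpa using this.ne'
  have hval : r * ((r + b) * q - 4 * 0) / ((r + b) * (1 - q) + 7 * 0) = r * q / (1 - q) := by
    rw [mul_zero, mul_zero, sub_zero, add_zero, mul_left_comm, mul_div_mul_left _ _ hrb.ne']
  rw [hval] at ht
  refine le_of_tendsto ht ?_
  filter_upwards [Ioo_mem_nhdsGT (by positivity : 0 < (r + b) * q / 4)] with δ hδ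
  obtain ⟨hδ0, hδ1⟩ := hδ
  have hf : 0 < (r + b) * q - 4 * δ := by linarith
  have hden : 0 < (r + b) * (1 - q) + 7 * δ := by nlinarith
  have hg : b + 3 * δ + r - ((r + b) * q - 4 * δ) = (r + b) * (1 - q) + 7 * δ := by ring
  obtain ⟨c, hc, h'⟩ := exists_le_quantError hsupp hr hf (by linarith)
    (eventually_rpow_le_card hsupp ⟨hq0, hq1⟩ hδ0 hlim hderiv hrq)
  rw [hg] at h'
  have := le_liminf_log_ratio (fun _ => quantError_nonneg _) ha hC h
    (div_pos hden (mul_pos hr hf)) hc h'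
  rwa [one_div_div] at this

lemma exists_mem_Ioo_differentiableAt (hsupp : ν (unitCube d)ᶜ = 0) {x y : ℝ} (hx : 0 ≤ x)
    (hxy : x < y) (hy : y ≤ 1) :
    ∃ q ∈ Set.Ioo x y, DifferentiableAt ℝ (lqSpectrum ν) q := by
  have hanti : AntitoneOn (lqSpectrum ν) (Set.Ioo x y) :=
    (lqSpectrum_antitoneOn hsupp).mono (Set.Ioo_subset_Ioo hx hy)
  have hae := hanti.neg.ae_differentiableWithinAt measurableSet_Ioo
  have : (ae (volume.restrict (Set.Ioo x y))).NeBot := by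
    rw [ae_neBot, Ne, Measure.restrict_eq_zero, Real.volume_Ioo]
    simpa using hxy
  obtain ⟨q, hq, hmem⟩ := (hae.and (ae_restrict_mem measurableSet_Ioo)).exists
  refine ⟨q, hmem, ?_⟩
  simpa using (hq.differentiableAt (isOpen_Ioo.mem_nhds hmem)).neg

lemma tendsto_mul_div_one_sub {y : ℝ} (hy : y < 1) (l : Filter ℝ) (hl : l ≤ nhds y) :
    Tendsto (fun q : ℝ => r * q / (1 - q)) l (nhds (r * y / (1 - y))) := by
  refine Tendsto.mono_left (ContinuousAt.tendsto ?_) hl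
  exact ContinuousAt.div (by fun_prop) (by fun_prop) (by linarith)

lemma mul_div_one_sub_le (hr : 0 < r) {x y : ℝ} (hx : 0 ≤ x) (hxy : x ≤ y) (hy : y < 1) :
    r * x / (1 - x) ≤ r * y / (1 - y) := by
  have : 0 < 1 - y := by linarith
  have : 0 ≤ r * y := mul_nonneg hr.le (hx.trans hxy)
  gcongr

end Main

/-- `L^q`-regularity implies existence of the quantization dimension:
if `β_ν(q) = liminf_n β_{ν,n}(q)` for all `q` in a left neighbourhood of `q_r`,
or `β_ν` exists as a limit at `q_r` and is differentiable there, then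
`D_r(ν)` exists and equals `r q_r / (1 - q_r)`, where
`q_r = inf {q > 0 : β_ν(q) < r q}`. -/
theorem qdim_exists_of_lq_regular {d : ℕ} (ν : Measure (EuclideanSpace ℝ (Fin d)))
    [IsProbabilityMeasure ν]
    (hsupp : ν ({x : EuclideanSpace ℝ (Fin d) | ∀ i, x i ∈ Set.Ioc (0 : ℝ) 1}ᶜ) = 0)
    (r : ℝ) (hr : 0 < r) (qr : ℝ)
    (hqr : qr = sInf {q : ℝ | 0 < q ∧ lqSpectrum ν q < r * q})
    (hreg :
      (∃ ε > 0, ∀ q ∈ Set.Ioo (qr - ε) qr,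
        Filter.liminf (fun n : ℕ => lqSpectrumN ν n q) Filter.atTop = lqSpectrum ν q) ∨
      (Filter.Tendsto (fun n : ℕ => lqSpectrumN ν n qr) Filter.atTop
          (nhds (lqSpectrum ν qr)) ∧
        DifferentiableAt ℝ (lqSpectrum ν) qr)) :
    lowerQDim ν r = upperQDim ν r ∧ upperQDim ν r = r * qr / (1 - qr) := by
  change ν (unitCube d)ᶜ = 0 at hsupp
  set S : Set ℝ := {q : ℝ | 0 < q ∧ lqSpectrum ν q < r * q}
  have hbdd : BddBelow S := ⟨0, fun q hq => hq.1.le⟩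
  obtain ⟨p, hp, hpS⟩ : ∃ p ∈ Set.Ioo (0 : ℝ) 1, p ∈ S := by
    have hd : (0 : ℝ) < d + r := by positivity
    have hp : (d + r / 2) / (d + r) ∈ Set.Ioo (0 : ℝ) 1 :=
      ⟨by positivity, (div_lt_one hd).2 (by linarith)⟩
    refine ⟨_, hp, hp.1, (lqSpectrum_le hsupp hp).trans_lt ?_⟩
    rw [one_sub_div hd.ne', mul_div_assoc', mul_div_assoc', div_lt_div_iff_of_pos_right hd]
    nlinarith
  have hqr0 : 0 ≤ qr := hqr ▸ le_csInf ⟨p, hpS⟩ fun q hq => hq.1.le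
  have hqr1 : qr < 1 := hqr ▸ (csInf_le hbdd hpS).trans_lt hp.2
  have hbelow : ∀ q, 0 < q → q < qr → r * q ≤ lqSpectrum ν q := by
    intro q hq hlt
    by_contra! h
    exact hlt.not_ge (hqr ▸ csInf_le hbdd ⟨hq, h⟩)
  have hupper : upperQDim ν r ≤ r * qr / (1 - qr) := by
    refine ge_of_tendsto
      (tendsto_mul_div_one_sub hqr1 (nhdsWithin qr (Set.Ioi qr)) nhdsWithin_le_nhds) ?_
    filter_upwards [Ioo_mem_nhdsGT hqr1] with y hy
    obtain ⟨q, hqS, hqy⟩ := exists_lt_of_csInf_lt ⟨p, hpS⟩ (hqr ▸ hy.1)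
    exact (upperQDim_le hsupp hr ⟨hqS.1, hqy.trans hy.2⟩ hqS.2).trans
      (mul_div_one_sub_le hr hqS.1.le hqy.le hy.2)
  obtain ⟨C, hC, hle⟩ := exists_quantError_le hsupp hr hp hpS.2
  have ha : 0 < (1 - p) / (r * p) := div_pos (by linarith [hp.2]) (mul_pos hr hp.1)
  have hbddGe := isBoundedUnder_ge_log_ratio (fun _ => quantError_nonneg _) ha hC hle
  have hbddLe := isBoundedUnder_le_log_ratio (fun _ => quantError_nonneg _) ha hC hle
  have hlu : lowerQDim ν r ≤ upperQDim ν r := liminf_le_limsup hbddLe hbddGe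
  have hlower : r * qr / (1 - qr) ≤ lowerQDim ν r := by
    rcases hqr0.eq_or_lt with h0 | h0
    · rw [← h0, mul_zero, zero_div]
      exact le_liminf_of_le hbddLe.isCoboundedUnder_ge
        ((eventually_log_ratio_mem (fun _ => quantError_nonneg _) ha hC hle).mono fun _ h => h.1)
    · rcases hreg with ⟨ε, hε, hreg⟩ | ⟨hlim, hdiff⟩
      · refine le_of_tendsto
          (tendsto_mul_div_one_sub hqr1 (nhdsWithin qr (Set.Iio qr)) nhdsWithin_le_nhds) ?_
        filter_upwards [Ioo_mem_nhdsLT (max_lt h0 (sub_lt_self qr hε))] with y hy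
        have hy0 : 0 < y := (le_max_left _ _).trans_lt hy.1
        obtain ⟨q, hq, hdiff⟩ := exists_mem_Ioo_differentiableAt hsupp hy0.le hy.2 hqr1.le
        have hq0 := hy0.trans hq.1
        have hq01 : q ∈ Set.Ioo (0 : ℝ) 1 := ⟨hq0, hq.2.trans hqr1⟩
        have hlim := tendsto_of_liminf_eq_limsup
          (hreg q ⟨((le_max_right _ _).trans_lt hy.1).trans hq.1, hq.2⟩) rfl
          (isBoundedUnder_le_lqSpectrumN hsupp hq01) (isBoundedUnder_ge_lqSpectrumN hsupp hq01)
        exact (mul_div_one_sub_le hr hy0.le hq.1.le hq01.2).trans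
          (le_lowerQDim hsupp hr hp hpS.2 hq01 hlim hdiff (hbelow q hq0 hq.2))
      · refine le_lowerQDim hsupp hr hp hpS.2 ⟨h0, hqr1⟩ hlim hdiff ?_
        refine le_of_tendsto_of_tendsto (b := nhdsWithin qr (Set.Iio qr))
          (((continuous_const_mul r).tendsto qr).mono_left nhdsWithin_le_nhds)
          (hdiff.continuousAt.tendsto.mono_left nhdsWithin_le_nhds) ?_
        filter_upwards [Ioo_mem_nhdsLT h0] with q hq
        exact hbelow q hq.1 hq.2
  exact ⟨hlu.antisymm (hupper.trans hlower), hupper.antisymm (hlower.trans hlu)⟩
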